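/- arXiv:2506.08307 — 2 statements merged into one kernel-verified Lean document; each statement's English description precedes it below -/
import Mathlib

section
/- Teodorescu transform as right inverse of the Cauchy–Riemann operator: Let Ω be a bounded domain in M ≅ ℝ^{m+1} with smooth boundary and let f ∈ C¹(cl(Ω), 𝔸). Define T[f](x) := −∫_Ω E(y − x) f(y) dV(y) for x ∈ Ω. Then ∂̄ T[f](x) = f(x) for every x ∈ Ω, where ∂̄ = ∑_{s=0}^m v_s ∂/∂x_s. -/
open MeasureTheory

noncomputable section

/-- A real alternative `*`-algebra of finite dimension `> 1`, with a fixed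
hypercomplex basis `v 0 = 1, v 1, …, v m` spanning the hypercomplex subspace `M`.
Multiplication is `ℝ`-bilinear (bundled as a linear map). -/
structure HCAlg (𝔸 : Type) [NormedAddCommGroup 𝔸] [NormedSpace ℝ 𝔸] (m : ℕ) : Type where
  mul : 𝔸 →ₗ[ℝ] 𝔸 →ₗ[ℝ] 𝔸
  one : 𝔸
  conj : 𝔸 →ₗ[ℝ] 𝔸
  findim : FiniteDimensional ℝ 𝔸
  dim_gt_one : 1 < Module.finrank ℝ 𝔸
  one_mul' : ∀ a, mul one a = a
  mul_one' : ∀ a, mul a one = a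
  alt_left : ∀ a b, mul a (mul a b) = mul (mul a a) b
  alt_right : ∀ a b, mul (mul b a) a = mul b (mul a a)
  conj_invol : ∀ a, conj (conj a) = a
  conj_mul' : ∀ a b, conj (mul a b) = mul (conj b) (conj a)
  conj_one : conj one = one
  hm : 1 ≤ m
  v : Fin (m + 1) → 𝔸
  v_indep : LinearIndependent ℝ v
  v_zero : v 0 = one
  v_trace : ∀ s, s ≠ 0 → v s + conj (v s) = 0
  v_norm : ∀ s, s ≠ 0 → mul (v s) (conj (v s)) = one
  v_anticomm : ∀ s t, s ≠ 0 → t ≠ 0 → s ≠ t → mul (v s) (v t) = -(mul (v t) (v s))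

variable {𝔸 : Type} [NormedAddCommGroup 𝔸] [NormedSpace ℝ 𝔸] {m n : ℕ}

/-- `M^n`, identified with `ℝ^{(m+1)n}` via the coordinates `x j s`. -/
abbrev Mn (n m : ℕ) := Fin n → Fin (m + 1) → ℝ

/-- Euclidean norm of a point of `M` (in coordinates). -/
def enormM (c : Fin (m + 1) → ℝ) : ℝ := Real.sqrt (∑ s, c s ^ 2)

/-- Euclidean norm of a point of `M^n` (in coordinates). -/
def enormMn (x : Mn n m) : ℝ := Real.sqrt (∑ j, ∑ s, x j s ^ 2)

/-- Partial derivative `∂f/∂x_{j,s}` for functions on `M^n`. -/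
def pd {E : Type} [NormedAddCommGroup E] [NormedSpace ℝ E]
    (f : Mn n m → E) (j : Fin n) (s : Fin (m + 1)) (x : Mn n m) : E :=
  fderiv ℝ f x (Pi.single j (Pi.single s 1))

/-- Partial derivative `∂f/∂x_s` for functions on `M`. -/
def pd1 {E : Type} [NormedAddCommGroup E] [NormedSpace ℝ E]
    (f : (Fin (m + 1) → ℝ) → E) (s : Fin (m + 1)) (x : Fin (m + 1) → ℝ) : E :=
  fderiv ℝ f x (Pi.single s 1)

/-- The Dirac (Cauchy–Riemann) operator `∂̄_j = ∑_s v_s ∂/∂x_{j,s}`. -/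
def dbar (H : HCAlg 𝔸 m) (f : Mn n m → 𝔸) (j : Fin n) (x : Mn n m) : 𝔸 :=
  ∑ s, H.mul (H.v s) (pd f j s x)

/-- The conjugated Dirac operator `∂_j = ∑_s v_s^c ∂/∂x_{j,s}`. -/
def dconj (H : HCAlg 𝔸 m) (f : Mn n m → 𝔸) (j : Fin n) (x : Mn n m) : 𝔸 :=
  ∑ s, H.mul (H.conj (H.v s)) (pd f j s x)

/-- The Laplacian `Δ_j = ∑_s ∂²/∂x_{j,s}²` in the `j`-th block of variables. -/
def lap {E : Type} [NormedAddCommGroup E] [NormedSpace ℝ E]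
    (f : Mn n m → E) (j : Fin n) (x : Mn n m) : E :=
  ∑ s, pd (pd f j s) j s x

/-- Surface area of the unit `(N-1)`-sphere in `ℝ^N`: `σ_N = 2 π^{N/2} / Γ(N/2)`. -/
def usigma (N : ℕ) : ℝ := 2 * Real.pi ^ ((N : ℝ) / 2) / Real.Gamma ((N : ℝ) / 2)

/-- Embedding of coordinates into the hypercomplex subspace `M ⊆ 𝔸`. -/
def embM (H : HCAlg 𝔸 m) (c : Fin (m + 1) → ℝ) : 𝔸 := ∑ s, c s • H.v s

/-- The Cauchy kernel `E(x) = σ_{m+1}⁻¹ x^c / |x|^{m+1}` on `M`. -/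
def CauchyE (H : HCAlg 𝔸 m) (c : Fin (m + 1) → ℝ) : 𝔸 :=
  (usigma (m + 1) * enormM c ^ (m + 1))⁻¹ • H.conj (embM H c)

/-- The Bochner–Martinelli kernel components `K_j(x) = σ_N⁻¹ x_j^c / |x|^N`, `N = (m+1)n`. -/
def Kker (H : HCAlg 𝔸 m) (n : ℕ) (j : Fin n) (x : Mn n m) : 𝔸 :=
  (usigma ((m + 1) * n) * enormMn x ^ ((m + 1) * n))⁻¹ • H.conj (embM H (x j))

/-- `Tsol g (x) = −∫_M E(y₁ − x₁) (g(y₁, x⁰)) dV(y₁)`. -/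
def Tsol (H : HCAlg 𝔸 m) (hn : 0 < n) (g : Mn n m → 𝔸) (x : Mn n m) : 𝔸 :=
  - ∫ y1 : Fin (m + 1) → ℝ,
      H.mul (CauchyE H (y1 - x ⟨0, hn⟩)) (g (Function.update x ⟨0, hn⟩ y1))

/-- `Fint g (x) = ∫_M E(y₁) (g(y₁ + x₁, x⁰)) dV(y₁)`. -/
def Fint (H : HCAlg 𝔸 m) (hn : 0 < n) (g : Mn n m → 𝔸) (x : Mn n m) : 𝔸 :=
  ∫ y1 : Fin (m + 1) → ℝ,
      H.mul (CauchyE H y1) (g (Function.update x ⟨0, hn⟩ (y1 + x ⟨0, hn⟩)))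


section CliffordKernel

open Filter Topology Set Metric

variable {F : Type*} [NormedAddCommGroup F] [NormedSpace ℝ F]

/-- The regularised Cauchy kernel `w ↦ (|w|² + e)^{-(m+1)/2} ∑ₜ wₜ Pₜ`, with values in operators. -/
def cliffordKernel (P : Fin (m + 1) → F →L[ℝ] F) (e : ℝ) (w : Fin (m + 1) → ℝ) : F →L[ℝ] F :=
  ((∑ s, w s ^ 2 + e) ^ (-((m : ℝ) + 1) / 2)) • ∑ t, w t • P t

lemma contDiffAt_cliffordKernel (P : Fin (m + 1) → F →L[ℝ] F) {e : ℝ} {w : Fin (m + 1) → ℝ}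
    (h : 0 < ∑ s, w s ^ 2 + e) : ContDiffAt ℝ 1 (cliffordKernel P e) w := by
  unfold cliffordKernel
  have h1 : ContDiffAt ℝ 1 (fun w : Fin (m + 1) → ℝ => ∑ s, w s ^ 2 + e) w := by fun_prop
  have h2 : ContDiffAt ℝ 1 (fun w : Fin (m + 1) → ℝ => ∑ t, w t • P t) w := by fun_prop
  exact (h1.rpow_const_of_ne h.ne').smul h2

lemma fderiv_cliffordKernel_single (P : Fin (m + 1) → F →L[ℝ] F) {e : ℝ} {w : Fin (m + 1) → ℝ}
    (h : 0 < ∑ s, w s ^ 2 + e) (s : Fin (m + 1)) :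
    fderiv ℝ (cliffordKernel P e) w (Pi.single s 1) =
      (∑ s, w s ^ 2 + e) ^ (-((m : ℝ) + 1) / 2) • P s +
      (-((m : ℝ) + 1) * (∑ s, w s ^ 2 + e) ^ (-((m : ℝ) + 1) / 2 - 1) * w s) •
        ∑ t, w t • P t := by
  have h1 : HasFDerivAt (fun w : Fin (m + 1) → ℝ => ∑ s, w s ^ 2 + e)
      (∑ s, (2 * w s) • ContinuousLinearMap.proj (R := ℝ) (φ := fun _ : Fin (m + 1) => ℝ) s) w := by
    refine HasFDerivAt.add_const _ (HasFDerivAt.fun_sum fun i _ => ?_)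
    have := (ContinuousLinearMap.proj (R := ℝ) (φ := fun _ : Fin (m + 1) => ℝ) i).hasFDerivAt
      (x := w)
    simpa using this.pow 2
  have h2 : HasFDerivAt (fun w : Fin (m + 1) → ℝ => ∑ t, w t • P t)
      (∑ t, (ContinuousLinearMap.proj (R := ℝ) (φ := fun _ : Fin (m + 1) => ℝ) t).smulRight (P t))
      w := by
    refine HasFDerivAt.fun_sum fun i _ => ?_
    exact ((ContinuousLinearMap.proj (R := ℝ) (φ := fun _ : Fin (m + 1) => ℝ) i).smulRight
      (P i)).hasFDerivAt
  have h3 := (h1.rpow_const (p := -((m : ℝ) + 1) / 2) (Or.inl h.ne')).smul h2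
  have h4 : fderiv ℝ (cliffordKernel P e) w = _ := h3.fderiv
  rw [h4]
  simp only [add_apply, smul_apply,
    ContinuousLinearMap.smulRight_apply, sum_apply,
    ContinuousLinearMap.proj_apply, Pi.single_apply, ite_smul, one_smul, zero_smul,
    Finset.sum_ite_eq', Finset.mem_univ, if_true, smul_eq_mul, mul_ite, mul_one, mul_zero]
  congr 2
  ring

/-- The regularised Cauchy kernel is mapped by the Dirac operator to an approximate identity. -/
lemma sum_apply_fderiv_cliffordKernel {A P : Fin (m + 1) → F →L[ℝ] F}
    (hAP : ∀ s a, A s (P s a) = a)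
    (hAP' : ∀ (w : Fin (m + 1) → ℝ) a, ∑ s, w s • A s (∑ t, w t • P t a) = (∑ s, w s ^ 2) • a)
    {e : ℝ} {w : Fin (m + 1) → ℝ} (h : 0 < ∑ s, w s ^ 2 + e) (a : F) :
    ∑ s, A s (fderiv ℝ (cliffordKernel P e) w (Pi.single s 1) a) =
      (((m : ℝ) + 1) * e * (∑ s, w s ^ 2 + e) ^ (-((m : ℝ) + 1) / 2 - 1)) • a := by
  simp only [fderiv_cliffordKernel_single P h, add_apply,
    smul_apply, sum_apply, map_add, map_smul, hAP,
    Finset.sum_add_distrib, Finset.sum_const, Finset.card_univ, Fintype.card_fin]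
  simp only [mul_smul, ← Finset.smul_sum, hAP']
  have h5 : (∑ s, w s ^ 2 + e) ^ (-((m : ℝ) + 1) / 2) =
      (∑ s, w s ^ 2 + e) ^ (-((m : ℝ) + 1) / 2 - 1) * (∑ s, w s ^ 2 + e) := by
    rw [← Real.rpow_add_one h.ne', sub_add_cancel]
  rw [h5, ← Nat.cast_smul_eq_nsmul ℝ]
  simp only [← mul_smul, ← add_smul]
  congr 1
  push_cast
  ring

lemma stronglyMeasurable_cliffordKernel (P : Fin (m + 1) → F →L[ℝ] F) (e : ℝ) :
    StronglyMeasurable (cliffordKernel P e) := by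
  unfold cliffordKernel
  have h1 : Measurable (fun w : Fin (m + 1) → ℝ => (∑ s, w s ^ 2 + e) ^ (-((m : ℝ) + 1) / 2)) := by
    fun_prop
  have h2 : Continuous (fun w : Fin (m + 1) → ℝ => ∑ t, w t • P t) := by fun_prop
  exact h1.stronglyMeasurable.smul h2.stronglyMeasurable

lemma norm_sq_le_sum_sq (w : Fin (m + 1) → ℝ) : ‖w‖ ^ 2 ≤ ∑ s, w s ^ 2 := by
  have : ‖w‖ ≤ √(∑ s, w s ^ 2) := by
    refine (pi_norm_le_iff_of_nonneg (Real.sqrt_nonneg _)).2 fun i => ?_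
    refine Real.le_sqrt_of_sq_le ?_
    rw [Real.norm_eq_abs, sq_abs]
    exact Finset.single_le_sum (f := fun s => w s ^ 2) (fun _ _ => sq_nonneg _) (Finset.mem_univ i)
  have h0 : 0 ≤ ∑ s, w s ^ 2 := by positivity
  calc ‖w‖ ^ 2 ≤ √(∑ s, w s ^ 2) ^ 2 := by gcongr
    _ = _ := Real.sq_sqrt h0

lemma norm_cliffordKernel_le (P : Fin (m + 1) → F →L[ℝ] F) {e : ℝ} (he : 0 ≤ e)
    (w : Fin (m + 1) → ℝ) :
    ‖cliffordKernel P e w‖ ≤ (∑ t, ‖P t‖) * ‖w‖ ^ (-(m : ℝ)) := by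
  rcases eq_or_ne w 0 with rfl | hw
  · simp only [cliffordKernel, Pi.zero_apply, zero_smul, Finset.sum_const_zero, smul_zero,
      norm_zero]
    positivity
  have hw' : 0 < ‖w‖ := norm_pos_iff.2 hw
  have h1 : (∑ s, w s ^ 2 + e) ^ (-((m : ℝ) + 1) / 2) ≤ ‖w‖ ^ (-((m : ℝ) + 1)) := by
    calc (∑ s, w s ^ 2 + e) ^ (-((m : ℝ) + 1) / 2) ≤ (‖w‖ ^ 2) ^ (-((m : ℝ) + 1) / 2) := by
          refine Real.rpow_le_rpow_of_nonpos (by positivity) ?_ ?_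
          · linarith [norm_sq_le_sum_sq w]
          · have : (0 : ℝ) ≤ m := by positivity
            linarith
      _ = _ := by
          rw [← Real.rpow_natCast, ← Real.rpow_mul hw'.le]
          congr 1
          push_cast
          ring
  have h2 : ‖∑ t, w t • P t‖ ≤ (∑ t, ‖P t‖) * ‖w‖ := by
    rw [Finset.sum_mul]
    refine norm_sum_le_of_le _ fun t _ => ?_
    rw [norm_smul, mul_comm]
    gcongr
    exact norm_le_pi_norm w t
  rw [cliffordKernel, norm_smul, Real.norm_of_nonneg (by positivity)]
  calc _ ≤ ‖w‖ ^ (-((m : ℝ) + 1)) * ((∑ t, ‖P t‖) * ‖w‖) := by gcongr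
    _ = (∑ t, ‖P t‖) * (‖w‖ ^ (-((m : ℝ) + 1)) * ‖w‖) := by ring
    _ = _ := by
      rw [← Real.rpow_add_one hw'.ne']
      congr 2
      ring

lemma cliffordKernel_neg (P : Fin (m + 1) → F →L[ℝ] F) (e : ℝ) (w : Fin (m + 1) → ℝ) :
    cliffordKernel P e (-w) = -cliffordKernel P e w := by
  simp [cliffordKernel]

lemma locallyIntegrable_norm_rpow_neg :
    LocallyIntegrable (fun w : Fin (m + 1) → ℝ => ‖w‖ ^ (-(m : ℝ))) := by
  refine locallyIntegrable_iff.2 fun k hk => ?_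
  obtain ⟨r, hr, hkr⟩ := hk.isBounded.subset_ball_lt 0 0
  refine IntegrableOn.mono_set ?_ hkr
  rw [integrableOn_fun_norm_addHaar volume (f := fun x => x ^ (-(m : ℝ)))]
  refine (integrableOn_const (C := (1 : ℝ)) (by simp) (by simp)).congr_fun (fun x hx => ?_)
    measurableSet_Ioo
  simp [Real.rpow_neg hx.1.le, mul_inv_cancel₀ (pow_pos hx.1 m).ne']

lemma locallyIntegrable_cliffordKernel (P : Fin (m + 1) → F →L[ℝ] F) {e : ℝ} (he : 0 ≤ e) :
    LocallyIntegrable (cliffordKernel P e) := by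
  refine (locallyIntegrable_norm_rpow_neg.smul (∑ t, ‖P t‖)).mono
    (stronglyMeasurable_cliffordKernel P e).aestronglyMeasurable (.of_forall fun w => ?_)
  refine (norm_cliffordKernel_le P he w).trans (le_of_eq ?_)
  simp only [Pi.smul_apply, smul_eq_mul]
  rw [Real.norm_of_nonneg (by positivity)]

/-- The Poisson-type kernel `(m+1) (|w|² + 1)^{-(m+1)/2 - 1}` on `ℝ^{m+1}`. -/
def poissonBump (w : Fin (m + 1) → ℝ) : ℝ :=
  ((m : ℝ) + 1) * (∑ s, w s ^ 2 + 1) ^ (-((m : ℝ) + 1) / 2 - 1)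

lemma hasDerivAt_pow_mul_rpow (m : ℕ) (r : ℝ) :
    HasDerivAt (fun r : ℝ => r ^ (m + 1) * (r ^ 2 + 1) ^ (-((m : ℝ) + 1) / 2))
      (r ^ m * (((m : ℝ) + 1) * (r ^ 2 + 1) ^ (-((m : ℝ) + 1) / 2 - 1))) r := by
  have h : 0 < r ^ 2 + 1 := by positivity
  have h1 : HasDerivAt (fun r : ℝ => r ^ 2 + 1) (2 * r) r := by
    simpa using (hasDerivAt_pow 2 r).add_const 1
  have h2 := (hasDerivAt_pow (m + 1) r).mul (h1.rpow_const (p := -((m : ℝ) + 1) / 2) (Or.inl h.ne'))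
  refine h2.congr_deriv ?_
  have h5 : (r ^ 2 + 1) ^ (-((m : ℝ) + 1) / 2) =
      (r ^ 2 + 1) ^ (-((m : ℝ) + 1) / 2 - 1) * (r ^ 2 + 1) := by
    rw [← Real.rpow_add_one h.ne', sub_add_cancel]
  rw [h5]
  push_cast
  ring

lemma tendsto_pow_mul_rpow (m : ℕ) :
    Tendsto (fun r : ℝ => r ^ (m + 1) * (r ^ 2 + 1) ^ (-((m : ℝ) + 1) / 2)) atTop (𝓝 1) := by
  have h1 : Tendsto (fun r : ℝ => (1 + (r ^ 2)⁻¹) ^ (-((m : ℝ) + 1) / 2)) atTop (𝓝 1) := by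
    have h2 : Tendsto (fun r : ℝ => 1 + (r ^ 2)⁻¹) atTop (𝓝 (1 + 0)) :=
      tendsto_const_nhds.add (tendsto_inv_atTop_zero.comp (tendsto_pow_atTop two_ne_zero))
    have h3 := h2.rpow_const (p := -((m : ℝ) + 1) / 2) (Or.inl (by norm_num))
    simpa using h3
  refine h1.congr' ?_
  filter_upwards [eventually_gt_atTop 0] with r hr
  have h4 : r ^ 2 + 1 = r ^ 2 * (1 + (r ^ 2)⁻¹) := by field_simp
  have h5 : (r ^ 2) ^ (-((m : ℝ) + 1) / 2) = (r ^ (m + 1))⁻¹ := by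
    rw [← Real.rpow_natCast, ← Real.rpow_mul hr.le, ← Real.rpow_natCast, ← Real.rpow_neg hr.le]
    congr 1
    push_cast
    ring
  rw [h4, Real.mul_rpow (by positivity) (by positivity), h5, ← mul_assoc,
    mul_inv_cancel₀ (by positivity), one_mul]

lemma poissonBump_eq_norm_toLp (w : Fin (m + 1) → ℝ) :
    poissonBump w = (fun r : ℝ => ((m : ℝ) + 1) * (r ^ 2 + 1) ^ (-((m : ℝ) + 1) / 2 - 1))
      ‖WithLp.toLp 2 w‖ := by
  simp [poissonBump, EuclideanSpace.norm_sq_eq]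

lemma integrable_poissonBump : Integrable (poissonBump (m := m)) := by
  have h := (integrable_fun_norm_addHaar (volume : Measure (EuclideanSpace ℝ (Fin (m + 1))))
    (f := fun r : ℝ => ((m : ℝ) + 1) * (r ^ 2 + 1) ^ (-((m : ℝ) + 1) / 2 - 1))).2 (by
      simp only [finrank_euclideanSpace, Fintype.card_fin, Nat.add_sub_cancel, smul_eq_mul]
      exact integrableOn_Ioi_deriv_of_nonneg' (fun r _ => hasDerivAt_pow_mul_rpow m r)
        (fun r hr => by have := mem_Ioi.1 hr; positivity) (tendsto_pow_mul_rpow m))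
  refine (((PiLp.volume_preserving_toLp (Fin (m + 1))).integrable_comp_emb
    (MeasurableEquiv.toLp 2 _).measurableEmbedding).2 h).congr (.of_forall fun w => ?_)
  exact (poissonBump_eq_norm_toLp w).symm

lemma integral_poissonBump : ∫ w, poissonBump (m := m) w = usigma (m + 1) := by
  have h := integral_fun_norm_addHaar (volume : Measure (EuclideanSpace ℝ (Fin (m + 1))))
    (fun r : ℝ => ((m : ℝ) + 1) * (r ^ 2 + 1) ^ (-((m : ℝ) + 1) / 2 - 1))
  simp only [finrank_euclideanSpace, Fintype.card_fin, Nat.add_sub_cancel, smul_eq_mul] at h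
  rw [integral_Ioi_of_hasDerivAt_of_nonneg' (fun r _ => hasDerivAt_pow_mul_rpow m r)
    (fun r hr => by have := mem_Ioi.1 hr; positivity) (tendsto_pow_mul_rpow m)] at h
  simp only [poissonBump_eq_norm_toLp]
  rw [(PiLp.volume_preserving_toLp (Fin (m + 1))).integral_comp
    (MeasurableEquiv.toLp 2 _).measurableEmbedding
    (fun x => ((m : ℝ) + 1) * (‖x‖ ^ 2 + 1) ^ (-((m : ℝ) + 1) / 2 - 1)), h,
    measureReal_def, EuclideanSpace.volume_ball]
  have hpos : (0 : ℝ) < ((m + 1 : ℕ) : ℝ) / 2 := by positivity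
  have hG := Real.Gamma_pos_of_pos hpos
  have hG' : 0 ≤ √Real.pi ^ (m + 1) / Real.Gamma (((m + 1 : ℕ) : ℝ) / 2 + 1) := by
    have := Real.Gamma_pos_of_pos (add_pos hpos one_pos)
    positivity
  have hpi : √Real.pi ^ (m + 1) = Real.pi ^ (((m + 1 : ℕ) : ℝ) / 2) := by
    rw [Real.sqrt_eq_rpow, ← Real.rpow_natCast, ← Real.rpow_mul Real.pi_pos.le]
    congr 1
    ring
  simp only [ENNReal.ofReal_one, one_pow, one_mul, Fintype.card_fin, nsmul_eq_mul,
    ENNReal.toReal_ofReal hG']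
  rw [usigma, Real.Gamma_add_one hpos.ne', hpi]
  push_cast at hG ⊢
  simp only [ne_eq, Nat.add_eq_zero_iff, one_ne_zero, and_false, not_false_eq_true, zero_pow,
    zero_mul, sub_zero, mul_one]
  field_simp

lemma integral_sum_apply_cliffordKernel_fderiv {A P : Fin (m + 1) → F →L[ℝ] F}
    (hAP : ∀ s a, A s (P s a) = a)
    (hAP' : ∀ (w : Fin (m + 1) → ℝ) a, ∑ s, w s • A s (∑ t, w t • P t a) = (∑ s, w s ^ 2) • a)
    {e : ℝ} (he : 0 < e) {g : (Fin (m + 1) → ℝ) → F} (hg : ContDiff ℝ 1 g)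
    (hgc : HasCompactSupport g) :
    ∫ y, ∑ s, A s (cliffordKernel P e y (fderiv ℝ g y (Pi.single s 1))) =
      -∫ y : Fin (m + 1) → ℝ,
        (((m : ℝ) + 1) * e * (∑ s, y s ^ 2 + e) ^ (-((m : ℝ) + 1) / 2 - 1)) • g y := by
  have hK : ContDiff ℝ 1 (cliffordKernel P e) :=
    contDiff_iff_contDiffAt.2 fun w => contDiffAt_cliffordKernel P (by positivity)
  have hK0 := hK.continuous
  have hK1 := hK.continuous_fderiv one_ne_zero
  have hg0 := hg.continuous
  have hg1 := hg.continuous_fderiv one_ne_zero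
  have i1 (s) : Integrable fun y => A s (cliffordKernel P e y (fderiv ℝ g y (Pi.single s 1))) := by
    refine Continuous.integrable_of_hasCompactSupport (by fun_prop) ?_
    exact (hgc.fderiv ℝ).mono fun y hy h => hy (by simp [h])
  have i2 (s) : Integrable fun y => A s (fderiv ℝ (cliffordKernel P e) y (Pi.single s 1) (g y)) := by
    refine Continuous.integrable_of_hasCompactSupport (by fun_prop) ?_
    exact hgc.mono fun y hy h => hy (by simp [h])
  have i3 (s) : Integrable fun y => A s (cliffordKernel P e y (g y)) := by
    refine Continuous.integrable_of_hasCompactSupport (by fun_prop) ?_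
    exact hgc.mono fun y hy h => hy (by simp [h])
  rw [integral_finsetSum _ fun s _ => i1 s]
  have key (s) : ∫ y, A s (cliffordKernel P e y (fderiv ℝ g y (Pi.single s 1))) =
      -∫ y, A s (fderiv ℝ (cliffordKernel P e) y (Pi.single s 1) (g y)) :=
    integral_bilinear_fderiv_right_eq_neg_left_of_integrable
      (B := ContinuousLinearMap.compL ℝ F F F (A s)) (i2 s) (i1 s) (i3 s)
      (fun y _ => hK.differentiable one_ne_zero y) (fun y _ => hg.differentiable one_ne_zero y)
  simp only [key, Finset.sum_neg_distrib]
  rw [← integral_finsetSum _ fun s _ => i2 s]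
  congr 1
  refine integral_congr_ae (.of_forall fun y => ?_)
  exact sum_apply_fderiv_cliffordKernel hAP hAP' (by positivity) (g y)

lemma integral_approxIdentity_smul {ε : ℝ} (hε : 0 < ε) (g : (Fin (m + 1) → ℝ) → F) :
    ∫ y : Fin (m + 1) → ℝ,
      (((m : ℝ) + 1) * ε ^ 2 * (∑ s, y s ^ 2 + ε ^ 2) ^ (-((m : ℝ) + 1) / 2 - 1)) • g y =
      ∫ y, poissonBump y • g (ε • y) := by
  have h := Measure.integral_comp_smul volume (fun y : Fin (m + 1) → ℝ =>
    (((m : ℝ) + 1) * ε ^ 2 * (∑ s, y s ^ 2 + ε ^ 2) ^ (-((m : ℝ) + 1) / 2 - 1)) • g y) ε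
  rw [Module.finrank_fin_fun, abs_of_pos (by positivity), eq_inv_smul_iff₀ (by positivity)] at h
  rw [← h, ← integral_smul]
  refine integral_congr_ae (.of_forall fun y => ?_)
  simp only [← mul_smul, poissonBump]
  congr 1
  have h1 : ∑ s, (ε • y) s ^ 2 + ε ^ 2 = ε ^ 2 * (∑ s, y s ^ 2 + 1) := by
    simp only [Pi.smul_apply, smul_eq_mul, mul_pow, ← Finset.mul_sum]
    ring
  have h2 : (ε ^ 2) ^ (-((m : ℝ) + 1) / 2 - 1) = (ε ^ (m + 1) * ε ^ 2)⁻¹ := by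
    rw [← pow_add, ← Real.rpow_natCast ε 2, ← Real.rpow_mul hε.le, ← Real.rpow_natCast,
      ← Real.rpow_neg hε.le]
    congr 1
    push_cast
    ring
  rw [h1, Real.mul_rpow (by positivity) (by positivity), h2]
  field_simp

lemma tendsto_integral_poissonBump_smul [CompleteSpace F] {g : (Fin (m + 1) → ℝ) → F}
    (hg : Continuous g) (hgc : HasCompactSupport g) :
    Tendsto (fun ε : ℝ => ∫ y, poissonBump y • g (ε • y)) (𝓝[>] 0)
      (𝓝 (usigma (m + 1) • g 0)) := by
  obtain ⟨C, hC⟩ := hgc.exists_bound_of_continuous hg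
  rw [← integral_poissonBump, ← integral_smul_const]
  refine tendsto_integral_filter_of_dominated_convergence (fun y => ‖poissonBump y‖ * C)
    (.of_forall fun ε => ?_) (.of_forall fun ε => .of_forall fun y => ?_)
    (integrable_poissonBump.norm.mul_const C) (.of_forall fun y => ?_)
  · exact integrable_poissonBump.aestronglyMeasurable.smul
      (Continuous.aestronglyMeasurable (by fun_prop))
  · rw [norm_smul]
    gcongr
    exact hC _
  · have h : Continuous fun ε : ℝ => poissonBump y • g (ε • y) := by fun_prop
    simpa using (h.tendsto 0).mono_left nhdsWithin_le_nhds

lemma tendsto_cliffordKernel (P : Fin (m + 1) → F →L[ℝ] F) (w : Fin (m + 1) → ℝ) :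
    Tendsto (fun ε : ℝ => cliffordKernel P (ε ^ 2) w) (𝓝[>] 0) (𝓝 (cliffordKernel P 0 w)) := by
  rcases eq_or_ne w 0 with rfl | hw
  · simp [cliffordKernel]
  have hq : 0 < ∑ s, w s ^ 2 :=
    (pow_pos (norm_pos_iff.2 hw) 2).trans_le (norm_sq_le_sum_sq w)
  refine Tendsto.mono_left ?_ nhdsWithin_le_nhds
  refine Tendsto.smul_const (Tendsto.rpow_const ?_ (Or.inl ?_)) _
  · have h : Continuous fun ε : ℝ => ∑ s, w s ^ 2 + ε ^ 2 := by fun_prop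
    simpa using h.tendsto 0
  · simpa using hq.ne'

lemma tendsto_integral_sum_apply_cliffordKernel_fderiv (A P : Fin (m + 1) → F →L[ℝ] F)
    {g : (Fin (m + 1) → ℝ) → F} (hg : ContDiff ℝ 1 g) (hgc : HasCompactSupport g) :
    Tendsto (fun ε : ℝ =>
        ∫ y, ∑ s, A s (cliffordKernel P (ε ^ 2) y (fderiv ℝ g y (Pi.single s 1)))) (𝓝[>] 0)
      (𝓝 (∫ y, ∑ s, A s (cliffordKernel P 0 y (fderiv ℝ g y (Pi.single s 1))))) := by
  have hg1 := hg.continuous_fderiv one_ne_zero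
  refine tendsto_integral_filter_of_dominated_convergence
    (fun y => ((∑ s, ‖A s‖) * (∑ t, ‖P t‖)) * (‖y‖ ^ (-(m : ℝ)) • ‖fderiv ℝ g y‖))
    (.of_forall fun ε => ?_) (.of_forall fun ε => .of_forall fun y => ?_) ?_
    (.of_forall fun y => ?_)
  · refine Finset.aestronglyMeasurable_fun_sum _ fun s _ => ?_
    refine (A s).continuous.comp_aestronglyMeasurable ?_
    exact (ContinuousLinearMap.id ℝ (F →L[ℝ] F)).aestronglyMeasurable_comp₂
      (stronglyMeasurable_cliffordKernel P _).aestronglyMeasurable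
      (Continuous.aestronglyMeasurable (by fun_prop))
  · rw [mul_assoc, Finset.sum_mul]
    refine norm_sum_le_of_le _ fun s _ => ?_
    refine ((A s).le_opNorm _).trans ?_
    gcongr
    refine (ContinuousLinearMap.le_opNorm _ _).trans ?_
    rw [smul_eq_mul, ← mul_assoc]
    gcongr
    · exact norm_cliffordKernel_le P (sq_nonneg ε) y
    · simpa [Pi.norm_single] using (fderiv ℝ g y).le_opNorm (Pi.single s 1)
  · refine Integrable.const_mul ?_ _
    exact locallyIntegrable_norm_rpow_neg.integrable_smul_right_of_hasCompactSupport
      (by fun_prop) (hgc.fderiv ℝ).norm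
  · refine tendsto_finsetSum _ fun s _ => ((A s).continuous.tendsto _).comp ?_
    exact (((ContinuousLinearMap.apply ℝ F (fderiv ℝ g y (Pi.single s 1))).continuous.tendsto
      _).comp (tendsto_cliffordKernel P y))

/-- The distributional identity `∂̄ E = δ₀` tested on compactly supported `C¹` functions. -/
lemma integral_sum_apply_cliffordKernel_zero_fderiv [CompleteSpace F]
    {A P : Fin (m + 1) → F →L[ℝ] F} (hAP : ∀ s a, A s (P s a) = a)
    (hAP' : ∀ (w : Fin (m + 1) → ℝ) a, ∑ s, w s • A s (∑ t, w t • P t a) = (∑ s, w s ^ 2) • a)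
    {g : (Fin (m + 1) → ℝ) → F} (hg : ContDiff ℝ 1 g) (hgc : HasCompactSupport g) :
    ∫ y, ∑ s, A s (cliffordKernel P 0 y (fderiv ℝ g y (Pi.single s 1))) =
      -(usigma (m + 1) • g 0) := by
  refine tendsto_nhds_unique (tendsto_integral_sum_apply_cliffordKernel_fderiv A P hg hgc) ?_
  refine (tendsto_integral_poissonBump_smul hg.continuous hgc).neg.congr' ?_
  filter_upwards [self_mem_nhdsWithin] with ε hε
  rw [integral_sum_apply_cliffordKernel_fderiv hAP hAP' (pow_pos hε 2) hg hgc,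
    integral_approxIdentity_smul hε]

/-- The symbol of the Dirac operator: `D ↦ ∑ₛ Aₛ (D eₛ)` for a differential `D`. -/
def diracSymbol (A : Fin (m + 1) → F →L[ℝ] F) : ((Fin (m + 1) → ℝ) →L[ℝ] F) →L[ℝ] F :=
  ∑ s, (A s).comp (ContinuousLinearMap.apply ℝ F (Pi.single s 1))

lemma diracSymbol_apply (A : Fin (m + 1) → F →L[ℝ] F) (D : (Fin (m + 1) → ℝ) →L[ℝ] F) :
    diracSymbol A D = ∑ s, A s (D (Pi.single s 1)) := by
  simp [diracSymbol]

open scoped Convolution in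
lemma hasFDerivAt_integral_cliffordKernel_of_hasCompactSupport [CompleteSpace F]
    {A P : Fin (m + 1) → F →L[ℝ] F} (hAP : ∀ s a, A s (P s a) = a)
    (hAP' : ∀ (w : Fin (m + 1) → ℝ) a, ∑ s, w s • A s (∑ t, w t • P t a) = (∑ s, w s ^ 2) • a)
    {g : (Fin (m + 1) → ℝ) → F} (hg : ContDiff ℝ 1 g) (hgc : HasCompactSupport g)
    (x : Fin (m + 1) → ℝ) :
    ∃ D, HasFDerivAt (fun z => ∫ y, cliffordKernel P 0 (y - z) (g y)) D x ∧
      diracSymbol A D = -(usigma (m + 1) • g x) := by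
  let L : (F →L[ℝ] F) →L[ℝ] F →L[ℝ] F := ContinuousLinearMap.id ℝ (F →L[ℝ] F)
  have hK := locallyIntegrable_cliffordKernel P le_rfl
  have h := (hgc.hasFDerivAt_convolution_right L hK hg x).neg
  have hconv : (fun z => ∫ y, cliffordKernel P 0 (y - z) (g y)) =
      -(cliffordKernel P 0 ⋆[L] g) := by
    ext1 z
    rw [Pi.neg_apply, convolution_eq_swap, ← integral_neg]
    refine integral_congr_ae (.of_forall fun y => ?_)
    simp only [L, ContinuousLinearMap.id_apply]
    rw [← neg_sub y z, cliffordKernel_neg, neg_apply, neg_neg]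
  rw [← hconv] at h
  refine ⟨_, h, ?_⟩
  have hint := (hgc.fderiv ℝ).convolutionExists_right (L.precompR (Fin (m + 1) → ℝ) :) hK
    (hg.continuous_fderiv one_ne_zero) x
  rw [map_neg, convolution_def, ← ContinuousLinearMap.integral_comp_comm _ hint, ← integral_neg]
  have hg' : ContDiff ℝ 1 fun t => g (x - t) := hg.comp (contDiff_const.sub contDiff_id)
  have hgc' : HasCompactSupport fun t => g (x - t) := hgc.comp_homeomorph (Homeomorph.subLeft x)
  have key := integral_sum_apply_cliffordKernel_zero_fderiv hAP hAP' hg' hgc'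
  rw [sub_zero] at key
  rw [← key]
  refine integral_congr_ae (.of_forall fun t => ?_)
  have hd : fderiv ℝ (fun t => g (x - t)) t = -fderiv ℝ g (x - t) := by
    have h1 := ((hg.differentiable one_ne_zero (x - t)).hasFDerivAt.comp t
      ((hasFDerivAt_id t).const_sub x)).fderiv
    refine h1.trans ?_
    ext v
    simp
  simp only [hd, diracSymbol_apply, neg_apply, map_neg, Finset.sum_neg_distrib]
  rfl

lemma sum_sq_pos {w : Fin (m + 1) → ℝ} (hw : w ≠ 0) : 0 < ∑ s, w s ^ 2 + 0 := by
  rw [add_zero]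
  exact (pow_pos (norm_pos_iff.2 hw) 2).trans_le (norm_sq_le_sum_sq w)

lemma contDiffAt_cliffordKernel_zero (P : Fin (m + 1) → F →L[ℝ] F) {w : Fin (m + 1) → ℝ}
    (hw : w ≠ 0) : ContDiffAt ℝ 1 (cliffordKernel P 0) w :=
  contDiffAt_cliffordKernel P (sum_sq_pos hw)

lemma exists_bound_cliffordKernel_zero (P : Fin (m + 1) → F →L[ℝ] F) {r : ℝ} (hr : 0 < r) (R : ℝ) :
    ∃ C, ∀ w : Fin (m + 1) → ℝ, r ≤ ‖w‖ → ‖w‖ ≤ R →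
      ‖cliffordKernel P 0 w‖ ≤ C ∧ ‖fderiv ℝ (cliffordKernel P 0) w‖ ≤ C := by
  have hk : IsCompact {w : Fin (m + 1) → ℝ | r ≤ ‖w‖ ∧ ‖w‖ ≤ R} := by
    refine (isCompact_closedBall (0 : Fin (m + 1) → ℝ) R).of_isClosed_subset ?_ fun w hw => by
      simpa using hw.2
    exact (isClosed_le continuous_const continuous_norm).inter
      (isClosed_le continuous_norm continuous_const)
  have hk0 : ∀ w ∈ {w : Fin (m + 1) → ℝ | r ≤ ‖w‖ ∧ ‖w‖ ≤ R}, w ≠ 0 := fun w hw =>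
    norm_pos_iff.1 (hr.trans_le hw.1)
  obtain ⟨C₁, h₁⟩ := hk.exists_bound_of_continuousOn (f := cliffordKernel P 0) fun w hw =>
    (contDiffAt_cliffordKernel_zero P (hk0 w hw)).continuousAt.continuousWithinAt
  obtain ⟨C₂, h₂⟩ := hk.exists_bound_of_continuousOn (f := fderiv ℝ (cliffordKernel P 0))
    fun w hw => ((contDiffAt_cliffordKernel_zero P (hk0 w hw)).fderiv_right
      (m := 0) le_rfl).continuousAt.continuousWithinAt
  exact ⟨max C₁ C₂, fun w hr hR => ⟨(h₁ w ⟨hr, hR⟩).trans (le_max_left _ _),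
    (h₂ w ⟨hr, hR⟩).trans (le_max_right _ _)⟩⟩

lemma hasFDerivAt_integral_cliffordKernel_of_eq_zero [FiniteDimensional ℝ F]
    {A P : Fin (m + 1) → F →L[ℝ] F} (hAP : ∀ s a, A s (P s a) = a)
    (hAP' : ∀ (w : Fin (m + 1) → ℝ) a, ∑ s, w s • A s (∑ t, w t • P t a) = (∑ s, w s ^ 2) • a)
    {Ω : Set (Fin (m + 1) → ℝ)} (hΩ : MeasurableSet Ω) (hΩb : Bornology.IsBounded Ω)
    {h : (Fin (m + 1) → ℝ) → F} (hh : IntegrableOn h Ω) {x : Fin (m + 1) → ℝ} {r : ℝ} (hr : 0 < r)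
    (hx : ∀ y ∈ ball x r, h y = 0) :
    (∀ z ∈ ball x (r / 2), IntegrableOn (fun y => cliffordKernel P 0 (y - z) (h y)) Ω) ∧
    ∃ D, HasFDerivAt (fun z => ∫ y in Ω, cliffordKernel P 0 (y - z) (h y)) D x ∧
      diracSymbol A D = 0 := by
  have : CompleteSpace F := FiniteDimensional.complete ℝ F
  obtain ⟨R, hR⟩ := hΩb.subset_closedBall x
  obtain ⟨C, hC⟩ := exists_bound_cliffordKernel_zero P (half_pos hr) (R + r / 2)
  have hdist {y z : Fin (m + 1) → ℝ} (hy : y ∈ Ω) (hyx : y ∉ ball x r) (hz : z ∈ ball x (r / 2)) :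
      r / 2 ≤ ‖y - z‖ ∧ ‖y - z‖ ≤ R + r / 2 := by
    have h1 := mem_closedBall.1 (hR hy)
    rw [mem_ball, not_lt] at hyx
    rw [mem_ball] at hz
    rw [← dist_eq_norm]
    have h2 := dist_triangle y z x
    have h3 := dist_triangle_right y z x
    constructor <;> linarith
  have hΩae : ∀ᵐ y ∂volume.restrict Ω, y ∈ Ω := ae_restrict_mem hΩ
  have hmeas (z : Fin (m + 1) → ℝ) :
      AEStronglyMeasurable (fun y => cliffordKernel P 0 (y - z) (h y)) (volume.restrict Ω) :=
    (ContinuousLinearMap.id ℝ (F →L[ℝ] F)).aestronglyMeasurable_comp₂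
      ((stronglyMeasurable_cliffordKernel P 0).comp_measurable
        (measurable_id.sub_const z)).aestronglyMeasurable hh.aestronglyMeasurable
  have hint : ∀ z ∈ ball x (r / 2),
      IntegrableOn (fun y => cliffordKernel P 0 (y - z) (h y)) Ω := by
    intro z hz
    refine Integrable.mono' (hh.norm.const_mul C) (hmeas z) ?_
    filter_upwards [hΩae] with y hy
    by_cases hyx : y ∈ ball x r
    · simp [hx y hyx]
    · obtain ⟨h1, h2⟩ := hdist hy hyx hz
      exact ContinuousLinearMap.le_of_opNorm_le _ (hC _ h1 h2).1 _
  refine ⟨hint, ?_⟩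
  let F' : (Fin (m + 1) → ℝ) → (Fin (m + 1) → ℝ) → (Fin (m + 1) → ℝ) →L[ℝ] F := fun z y =>
    -(fderiv ℝ (cliffordKernel P 0) (y - z)).flip (h y)
  have hF'meas : AEStronglyMeasurable (F' x) (volume.restrict Ω) := by
    borelize ((Fin (m + 1) → ℝ) →L[ℝ] F →L[ℝ] F)
    have h1 : StronglyMeasurable fun y => fderiv ℝ (cliffordKernel P 0) (y - x) :=
      ((measurable_fderiv ℝ (cliffordKernel P 0)).comp
        (measurable_id.sub_const x)).stronglyMeasurable
    exact ((ContinuousLinearMap.flipₗᵢ ℝ (Fin (m + 1) → ℝ) F F :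
      _ ≃ₗᵢ[ℝ] _).toContinuousLinearEquiv.toContinuousLinearMap.aestronglyMeasurable_comp₂
        h1.aestronglyMeasurable hh.aestronglyMeasurable).neg
  have hbound : ∀ᵐ y ∂volume.restrict Ω, ∀ z ∈ ball x (r / 2), ‖F' z y‖ ≤ C * ‖h y‖ := by
    filter_upwards [hΩae] with y hy z hz
    by_cases hyx : y ∈ ball x r
    · simp [F', hx y hyx]
    · obtain ⟨h1, h2⟩ := hdist hy hyx hz
      rw [norm_neg]
      refine ContinuousLinearMap.le_of_opNorm_le _ ?_ _
      rw [ContinuousLinearMap.opNorm_flip]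
      exact (hC _ h1 h2).2
  have hdiff : ∀ᵐ y ∂volume.restrict Ω, ∀ z ∈ ball x (r / 2),
      HasFDerivAt (fun z => cliffordKernel P 0 (y - z) (h y)) (F' z y) z := by
    filter_upwards [hΩae] with y hy z hz
    by_cases hyx : y ∈ ball x r
    · simpa [F', hx y hyx] using hasFDerivAt_const (0 : F) z
    · have hne : y - z ≠ 0 := norm_pos_iff.1 ((half_pos hr).trans_le (hdist hy hyx hz).1)
      have h1 := ((contDiffAt_cliffordKernel_zero P hne).differentiableAt
        one_ne_zero).hasFDerivAt.comp z ((hasFDerivAt_id z).const_sub y)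
      refine ((ContinuousLinearMap.apply ℝ F (h y)).hasFDerivAt.comp z h1).congr_fderiv ?_
      ext v
      simp [F']
  refine ⟨_, hasFDerivAt_integral_of_dominated_of_fderiv_le (ball_mem_nhds x (half_pos hr))
    (.of_forall hmeas) (hint x (mem_ball_self (half_pos hr))) hF'meas hbound
    (hh.norm.const_mul C) hdiff, ?_⟩
  have hF'int : Integrable (F' x) (volume.restrict Ω) := by
    refine Integrable.mono' (hh.norm.const_mul C) hF'meas ?_
    filter_upwards [hbound] with y hy
    exact hy x (mem_ball_self (half_pos hr))
  rw [← ContinuousLinearMap.integral_comp_comm _ hF'int]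
  refine integral_eq_zero_of_ae ?_
  filter_upwards [hΩae] with y hy
  by_cases hyx : y ∈ ball x r
  · simp [F', hx y hyx]
  · have hne : y - x ≠ 0 := norm_pos_iff.1
      ((half_pos hr).trans_le (hdist hy hyx (mem_ball_self (half_pos hr))).1)
    have h1 := sum_apply_fderiv_cliffordKernel hAP hAP' (sum_sq_pos hne) (h y)
    simp only [mul_zero, zero_mul, zero_smul] at h1
    simp [F', diracSymbol_apply, h1]

lemma integrable_cliffordKernel_sub_apply (P : Fin (m + 1) → F →L[ℝ] F)
    {g : (Fin (m + 1) → ℝ) → F} (hg : Continuous g) (hgc : HasCompactSupport g)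
    (z : Fin (m + 1) → ℝ) : Integrable fun y => cliffordKernel P 0 (y - z) (g y) := by
  have h := hgc.convolutionExists_right (ContinuousLinearMap.id ℝ (F →L[ℝ] F))
    (locallyIntegrable_cliffordKernel P le_rfl) hg z
  refine (h.integrable.comp_sub_left z).neg.congr (.of_forall fun y => ?_)
  rw [Pi.neg_apply, ContinuousLinearMap.id_apply, ← neg_sub y z, cliffordKernel_neg, neg_apply,
    neg_neg, sub_neg_eq_add, add_sub_cancel]

/-- The generalised Teodorescu transform inverts the Dirac operator up to a constant. -/
theorem hasFDerivAt_setIntegral_cliffordKernel [FiniteDimensional ℝ F]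
    {A P : Fin (m + 1) → F →L[ℝ] F} (hAP : ∀ s a, A s (P s a) = a)
    (hAP' : ∀ (w : Fin (m + 1) → ℝ) a, ∑ s, w s • A s (∑ t, w t • P t a) = (∑ s, w s ^ 2) • a)
    {Ω : Set (Fin (m + 1) → ℝ)} (hΩ : IsOpen Ω) (hΩb : Bornology.IsBounded Ω)
    {f : (Fin (m + 1) → ℝ) → F} (hf : ContDiffOn ℝ 1 f Ω) (hfi : IntegrableOn f Ω)
    {x : Fin (m + 1) → ℝ} (hx : x ∈ Ω) :
    ∃ D, HasFDerivAt (fun z => ∫ y in Ω, cliffordKernel P 0 (y - z) (f y)) D x ∧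
      diracSymbol A D = -(usigma (m + 1) • f x) := by
  have : CompleteSpace F := FiniteDimensional.complete ℝ F
  obtain ⟨R, hR, hRΩ⟩ := nhds_basis_closedBall.mem_iff.1 (hΩ.mem_nhds hx)
  let χ : ContDiffBump x := ⟨R / 2, R, half_pos hR, half_lt_self hR⟩
  have hχΩ : tsupport χ ⊆ Ω := χ.tsupport_eq.subset.trans hRΩ
  have hgs : tsupport (fun y => χ y • f y) ⊆ Ω := (tsupport_smul_subset_left _ _).trans hχΩ
  have hg : ContDiff ℝ 1 fun y => χ y • f y := by
    refine contDiff_iff_contDiffAt.2 fun y => ?_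
    by_cases hy : y ∈ tsupport fun y => χ y • f y
    swap
    · exact contDiffAt_const.congr_of_eventuallyEq (notMem_tsupport_iff_eventuallyEq.1 hy)
    exact χ.contDiff.contDiffAt.smul (hf.contDiffAt (hΩ.mem_nhds (hgs hy)))
  have hgc : HasCompactSupport fun y => χ y • f y := χ.hasCompactSupport.smul_right
  have hh : IntegrableOn (fun y => f y - χ y • f y) Ω :=
    hfi.sub (hg.continuous.integrable_of_hasCompactSupport hgc).integrableOn
  have hh0 : ∀ y ∈ ball x (R / 2), f y - χ y • f y = 0 := fun y hy => by
    rw [χ.one_of_mem_closedBall (ball_subset_closedBall hy), one_smul, sub_self]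
  obtain ⟨D₁, hD₁, hA₁⟩ :=
    hasFDerivAt_integral_cliffordKernel_of_hasCompactSupport hAP hAP' hg hgc x
  obtain ⟨hint, D₂, hD₂, hA₂⟩ := hasFDerivAt_integral_cliffordKernel_of_eq_zero hAP hAP'
    hΩ.measurableSet hΩb hh (half_pos hR) hh0
  refine ⟨D₁ + D₂, (hD₁.add hD₂).congr_of_eventuallyEq ?_, ?_⟩
  · filter_upwards [ball_mem_nhds x (half_pos (half_pos hR))] with z hz
    have h1 : ∫ y in Ω, cliffordKernel P 0 (y - z) (χ y • f y) =
        ∫ y, cliffordKernel P 0 (y - z) (χ y • f y) :=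
      setIntegral_eq_integral_of_forall_compl_eq_zero fun y hy => by
        rw [image_eq_zero_of_notMem_tsupport fun h => hy (hχΩ h), zero_smul, map_zero]
    rw [Pi.add_apply, ← h1, ← integral_add
      (integrable_cliffordKernel_sub_apply P hg.continuous hgc z).integrableOn (hint z hz)]
    simp only [← map_add, add_sub_cancel]
  · rw [map_add, hA₁, hA₂, add_zero,
      χ.one_of_mem_closedBall (mem_closedBall_self χ.rIn_pos.le), one_smul]

end CliffordKernel

namespace HCAlg

variable (H : HCAlg 𝔸 m)

lemma mul_mul_add_mul_mul (a b c : 𝔸) :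
    H.mul a (H.mul b c) + H.mul b (H.mul a c) = H.mul (H.mul a b + H.mul b a) c := by
  have h := H.alt_left (a + b) c
  have ha := H.alt_left a c
  have hb := H.alt_left b c
  simp only [map_add, LinearMap.add_apply] at h ⊢
  rw [ha, hb] at h
  linear_combination (norm := module) h

lemma conj_v_of_ne_zero {s : Fin (m + 1)} (hs : s ≠ 0) : H.conj (H.v s) = -H.v s :=
  (neg_eq_of_add_eq_zero_right (H.v_trace s hs)).symm

lemma conj_v_zero : H.conj (H.v 0) = H.one := by
  rw [H.v_zero, H.conj_one]

lemma mul_conj_v_mul (s : Fin (m + 1)) (a : 𝔸) :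
    H.mul (H.v s) (H.mul (H.conj (H.v s)) a) = a := by
  rcases eq_or_ne s 0 with rfl | hs
  · rw [H.conj_v_zero, H.v_zero, H.one_mul', H.one_mul']
  · have h := H.v_norm s hs
    rw [H.conj_v_of_ne_zero hs, map_neg] at h
    rw [H.conj_v_of_ne_zero hs, map_neg, LinearMap.neg_apply, map_neg, H.alt_left,
      ← LinearMap.neg_apply, ← map_neg, h, H.one_mul']

lemma mul_conj_v_mul_add {s t : Fin (m + 1)} (hst : s ≠ t) (a : 𝔸) :
    H.mul (H.v s) (H.mul (H.conj (H.v t)) a) + H.mul (H.v t) (H.mul (H.conj (H.v s)) a) = 0 := by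
  rcases eq_or_ne s 0 with rfl | hs
  · rw [H.conj_v_zero, H.conj_v_of_ne_zero hst.symm, H.v_zero, H.one_mul', H.one_mul', map_neg,
      LinearMap.neg_apply, neg_add_cancel]
  rcases eq_or_ne t 0 with rfl | ht
  · rw [H.conj_v_zero, H.conj_v_of_ne_zero hs, H.v_zero, H.one_mul', H.one_mul', map_neg,
      LinearMap.neg_apply, add_neg_cancel]
  · have h := H.mul_mul_add_mul_mul (H.v s) (H.v t) a
    rw [H.v_anticomm s t hs ht hst, neg_add_cancel, map_zero, LinearMap.zero_apply] at h
    rw [H.conj_v_of_ne_zero hs, H.conj_v_of_ne_zero ht]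
    simp only [map_neg, LinearMap.neg_apply]
    rw [← neg_add, h, neg_zero]

lemma sum_smul_mul_sum_conj_v (w : Fin (m + 1) → ℝ) (a : 𝔸) :
    ∑ s, w s • H.mul (H.v s) (∑ t, w t • H.mul (H.conj (H.v t)) a) = (∑ s, w s ^ 2) • a := by
  have hexp : ∑ s, w s • H.mul (H.v s) (∑ t, w t • H.mul (H.conj (H.v t)) a) =
      ∑ s, ∑ t, (w s * w t) • H.mul (H.v s) (H.mul (H.conj (H.v t)) a) := by
    simp only [map_sum, map_smul, Finset.smul_sum, mul_smul]
  have hsymm : ∀ s t, (w s * w t) • H.mul (H.v s) (H.mul (H.conj (H.v t)) a) +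
      (w t * w s) • H.mul (H.v t) (H.mul (H.conj (H.v s)) a) =
        if s = t then (2 * w s ^ 2) • a else 0 := by
    intro s t
    split_ifs with hst
    · subst hst
      rw [H.mul_conj_v_mul, ← add_smul]
      congr 1
      ring
    · rw [mul_comm (w t), ← smul_add, H.mul_conj_v_mul_add hst, smul_zero]
  have htwo : (2 : ℝ) • ∑ s, w s • H.mul (H.v s) (∑ t, w t • H.mul (H.conj (H.v t)) a) =
      (2 : ℝ) • (∑ s, w s ^ 2) • a := by
    rw [hexp, two_smul]
    nth_rewrite 2 [Finset.sum_comm]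
    simp only [← Finset.sum_add_distrib, hsymm, Finset.sum_ite_eq, Finset.mem_univ, if_true]
    rw [← Finset.sum_smul, ← Finset.mul_sum, mul_smul]
  exact smul_right_injective 𝔸 (two_ne_zero' ℝ) htwo

end HCAlg

lemma inv_enormM_pow (w : Fin (m + 1) → ℝ) :
    (enormM w ^ (m + 1))⁻¹ = (∑ s, w s ^ 2 + 0) ^ (-((m : ℝ) + 1) / 2) := by
  have h : 0 ≤ ∑ s, w s ^ 2 := by positivity
  rw [enormM, add_zero, Real.sqrt_eq_rpow, ← Real.rpow_natCast, ← Real.rpow_mul h,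
    ← Real.rpow_neg h]
  congr 1
  push_cast
  ring

lemma mul_cauchyE [FiniteDimensional ℝ 𝔸] (H : HCAlg 𝔸 m) (w : Fin (m + 1) → ℝ) (a : 𝔸) :
    H.mul (CauchyE H w) a = (usigma (m + 1))⁻¹ •
      cliffordKernel (fun s => (H.mul (H.conj (H.v s))).toContinuousLinearMap) 0 w a := by
  rw [CauchyE, embM, mul_inv, inv_enormM_pow, cliffordKernel]
  simp [mul_smul, sum_apply]

lemma usigma_pos (N : ℕ) (hN : 0 < N) : 0 < usigma N := by
  have := Real.Gamma_pos_of_pos (s := (N : ℝ) / 2) (by positivity)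
  have := Real.pi_pos
  unfold usigma
  positivity

/-- **Teodorescu transform as a right inverse of the Cauchy–Riemann operator**
(Theorem 5.1): for a bounded domain `Ω ⊆ M` with smooth boundary and
`f ∈ C¹(cl Ω, 𝔸)`, the transform `T[f](x) = −∫_Ω E(y − x) f(y) dV(y)` satisfies
`∂̄ T[f] = f` on `Ω`.  (The smooth boundary is encoded by local smooth defining
functions with nonvanishing differential.) -/
theorem teodorescu_right_inverse (H : HCAlg 𝔸 m)
    (Ω : Set (Fin (m + 1) → ℝ)) (hΩo : IsOpen Ω) (hΩc : IsConnected Ω)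
    (hΩb : Bornology.IsBounded Ω)
    (hsmooth : ∀ x ∈ frontier Ω, ∃ (U : Set (Fin (m + 1) → ℝ)) (ρ : (Fin (m + 1) → ℝ) → ℝ),
      IsOpen U ∧ x ∈ U ∧ ContDiff ℝ (⊤ : ℕ∞) ρ ∧ (∀ y ∈ U, (y ∈ Ω ↔ ρ y < 0)) ∧
      ∀ y ∈ U, fderiv ℝ ρ y ≠ 0)
    (f : (Fin (m + 1) → ℝ) → 𝔸) (hf : ContDiffOn ℝ 1 f (closure Ω)) :
    ∀ x ∈ Ω,
      (∑ s, H.mul (H.v s)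
        (pd1 (fun z => - ∫ y in Ω, H.mul (CauchyE H (y - z)) (f y)) s x)) = f x := by
  intro x hx
  have := H.findim
  have hfi : IntegrableOn f Ω :=
    (hf.continuousOn.integrableOn_compact hΩb.isCompact_closure).mono_set subset_closure
  obtain ⟨D, hD, hAD⟩ := hasFDerivAt_setIntegral_cliffordKernel
    (A := fun s => (H.mul (H.v s)).toContinuousLinearMap)
    (P := fun s => (H.mul (H.conj (H.v s))).toContinuousLinearMap)
    H.mul_conj_v_mul H.sum_smul_mul_sum_conj_v hΩo hΩb (hf.mono subset_closure) hfi hx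
  have hT := (hD.const_smul (usigma (m + 1))⁻¹).neg.fderiv
  simp only [mul_cauchyE, integral_smul, pd1]
  erw [hT]
  simp only [diracSymbol_apply, LinearMap.coe_toContinuousLinearMap'] at hAD
  simp only [neg_apply, smul_apply, map_neg, map_smul, Finset.sum_neg_distrib, ← Finset.smul_sum,
    hAD, smul_neg, neg_neg]
  exact inv_smul_smul₀ (usigma_pos _ m.succ_pos).ne' _

end
end

section
/- Regularity of monogenic functions: Let Ω be a domain in M^n ≅ ℝ^{(m+1)n} and let f ∈ C¹(Ω, 𝔸) be left monogenic, i.e. ∂̄_j f = 0 on Ω for j = 1, …, n. Then f is harmonic on Ω (every real component of f with respect to a real basis of 𝔸 satisfies Laplace's equation ∑_{j=1}^n ∑_{s=0}^m ∂²u/∂x_{j,s}² = 0) and, in particular, f ∈ C^∞(Ω, 𝔸). -/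
open MeasureTheory

noncomputable section

variable {𝔸 : Type} [NormedAddCommGroup 𝔸] [NormedSpace ℝ 𝔸] {m n : ℕ}

open scoped ContDiff in
/-- Integration by parts twice: the mixed pairing of the gradient of a test function with the
gradient of an affinely rescaled `C¹` function is symmetric in the two directions. -/
theorem integral_fderiv_smul_fderiv_comm {E F : Type*} [NormedAddCommGroup E] [NormedSpace ℝ E]
    [FiniteDimensional ℝ E] [MeasurableSpace E] [BorelSpace E] (μ : Measure E)
    [μ.IsAddHaarMeasure] [NormedAddCommGroup F] [NormedSpace ℝ F] [CompleteSpace F]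
    {Φ : E → ℝ} (hΦ : ContDiff ℝ ∞ Φ) (hΦc : HasCompactSupport Φ)
    {f : E → F} (hf : ContDiff ℝ 1 f) (x : E) (r : ℝ) (v w : E) :
    ∫ y, fderiv ℝ Φ y v • fderiv ℝ f (x - r • y) w ∂μ =
      ∫ y, fderiv ℝ Φ y w • fderiv ℝ f (x - r • y) v ∂μ := by
  have hΦ1 : ContDiff ℝ ∞ (fderiv ℝ Φ) := (contDiff_infty_iff_fderiv.1 hΦ).2
  have hdΦ (v : E) : ContDiff ℝ ∞ (fun y => fderiv ℝ Φ y v) := hΦ1.clm_apply contDiff_const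
  have hdΦc (v : E) : HasCompactSupport (fun y => fderiv ℝ Φ y v) := hΦc.fderiv_apply ℝ v
  have hddΦ (v w : E) : Continuous (fun y => fderiv ℝ (fun z => fderiv ℝ Φ z v) y w) :=
    (((contDiff_infty_iff_fderiv.1 (hdΦ v)).2).clm_apply contDiff_const).continuous
  have hddΦc (v w : E) : HasCompactSupport (fun y => fderiv ℝ (fun z => fderiv ℝ Φ z v) y w) :=
    (hdΦc v).fderiv_apply ℝ w
  rcases eq_or_ne r 0 with rfl | hr
  · have hzero (v : E) : ∫ y, fderiv ℝ Φ y v ∂μ = 0 := by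
      have := integral_smul_fderiv_eq_neg_fderiv_smul_of_integrable (μ := μ)
        (f := fun _ : E => (1 : ℝ)) (g := Φ) (v := v) (by simp)
        (by simpa using (hdΦ v).continuous.integrable_of_hasCompactSupport (hdΦc v))
        (by simpa using hΦ.continuous.integrable_of_hasCompactSupport hΦc)
        (by simp) (fun y _ => (hΦ.differentiable (by simp)) y)
      simpa using this
    simp [integral_smul_const, hzero]
  · have hg : ContDiff ℝ 1 (fun y => f (x - r • y)) := hf.comp (by fun_prop)
    have hgd (y w : E) : fderiv ℝ (fun y => f (x - r • y)) y w
        = (-r) • fderiv ℝ f (x - r • y) w := by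
      have h1 : HasFDerivAt (fun y : E => x - r • y) (-(r • ContinuousLinearMap.id ℝ E)) y :=
        ((hasFDerivAt_id y).const_smul r).const_sub x
      have h2 := ((hf.differentiable (by simp)) (x - r • y)).hasFDerivAt.comp y h1
      have h3 : fderiv ℝ (fun y => f (x - r • y)) y = _ := h2.fderiv
      rw [h3]
      simp
    have hg1 : Continuous (fderiv ℝ (fun y => f (x - r • y))) := hg.continuous_fderiv (by simp)
    have key (v w : E) : (-r) • ∫ y, fderiv ℝ Φ y v • fderiv ℝ f (x - r • y) w ∂μ =
        - ∫ y, fderiv ℝ (fun z => fderiv ℝ Φ z v) y w • f (x - r • y) ∂μ := by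
      rw [← integral_smul_fderiv_eq_neg_fderiv_smul_of_integrable
        (f := fun z => fderiv ℝ Φ z v) (g := fun y => f (x - r • y)) (v := w)]
      · rw [← integral_smul]
        congr 1 with y
        rw [hgd, smul_comm]
      · exact ((hddΦ v w).smul hg.continuous).integrable_of_hasCompactSupport
          (hddΦc v w).smul_right
      · exact ((hdΦ v).continuous.smul (hg1.clm_apply continuous_const))
          |>.integrable_of_hasCompactSupport (hdΦc v).smul_right
      · exact ((hdΦ v).continuous.smul hg.continuous).integrable_of_hasCompactSupport
          (hdΦc v).smul_right
      · exact fun y _ => (hdΦ v).differentiable (by simp) y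
      · exact fun y _ => hg.differentiable (by simp) y
    have hsymm (y : E) : fderiv ℝ (fun z => fderiv ℝ Φ z v) y w
        = fderiv ℝ (fun z => fderiv ℝ Φ z w) y v := by
      have hd : DifferentiableAt ℝ (fderiv ℝ Φ) y := hΦ1.differentiable (by simp) y
      have := (hΦ.contDiffAt (x := y)).isSymmSndFDerivAt
        (by simpa using WithTop.coe_le_coe.2 (le_top (a := (2 : ℕ∞)))) w v
      rw [fderiv_clm_apply hd (by fun_prop), fderiv_clm_apply hd (by fun_prop)]
      simpa using this
    refine smul_right_injective F (neg_ne_zero.2 hr) ?_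
    simp only [key, hsymm]

/-- A vector of `M^n` is the combination of the coordinate vectors given by its coordinates. -/
theorem sum_coord_smul_single (y : Mn n m) :
    ∑ j, ∑ s, y j s • (Pi.single j (Pi.single s 1) : Mn n m) = y := by
  ext j s
  simp only [Finset.sum_apply, Pi.smul_apply]
  rw [Finset.sum_eq_single j, Finset.sum_eq_single s]
  · simp
  · intro t _ ht
    simp [ht.symm]
  · simp
  · intro i _ hi
    simp [hi.symm]
  · simp

open scoped ContDiff in
/-- A radial bump function `φ` supported in the unit ball, such that the vector field `φ(y) y` is
the gradient of a compactly supported smooth function `Φ`. -/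
theorem exists_radial_bump_potential (n m : ℕ) : ∃ φ Φ : Mn n m → ℝ,
    ContDiff ℝ ∞ φ ∧ ContDiff ℝ ∞ Φ ∧ HasCompactSupport φ ∧ HasCompactSupport Φ ∧
    (∀ y, φ y ≠ 0 → ‖y‖ ≤ 1) ∧ 0 < ∫ y, φ y ∧
    ∀ y j s, fderiv ℝ Φ y (Pi.single j (Pi.single s 1)) = φ y * y j s := by
  set g : ℝ → ℝ := fun t => Real.smoothTransition (1 - t) with hg
  have hgs : ContDiff ℝ ∞ g := Real.smoothTransition.contDiff.comp (by fun_prop)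
  have hg0 (t : ℝ) (ht : 1 ≤ t) : g t = 0 :=
    Real.smoothTransition.zero_of_nonpos (by linarith)
  set G : ℝ → ℝ := fun t => (1 / 2) * ∫ u in (1 : ℝ)..t, g u with hG
  have hGd (t : ℝ) : HasDerivAt G ((1 / 2) * g t) t :=
    (intervalIntegral.integral_hasDerivAt_right (hgs.continuous.intervalIntegrable _ _)
      (hgs.continuous.stronglyMeasurableAtFilter _ _) hgs.continuous.continuousAt).const_mul _
  have hGs : ContDiff ℝ ∞ G := by
    rw [contDiff_infty_iff_deriv]
    refine ⟨fun t => (hGd t).differentiableAt, ?_⟩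
    rw [funext fun t => (hGd t).deriv]
    exact contDiff_const.mul hgs
  have hG0 (t : ℝ) (ht : 1 ≤ t) : G t = 0 := by
    have : ∫ u in (1 : ℝ)..t, g u = ∫ u in (1 : ℝ)..t, (0 : ℝ) := by
      refine intervalIntegral.integral_congr fun u hu => ?_
      rw [Set.uIcc_of_le ht] at hu
      exact hg0 u hu.1
    simp [hG, this]
  set q : Mn n m → ℝ := fun y => ∑ j, ∑ s, y j s ^ 2 with hq
  have hqs : ContDiff ℝ ∞ q := by fun_prop
  have hqn (y : Mn n m) (hy : q y < 1) : ‖y‖ ≤ 1 := by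
    refine (pi_norm_le_iff_of_nonneg zero_le_one).2 fun j =>
      (pi_norm_le_iff_of_nonneg zero_le_one).2 fun s => ?_
    have h1 : y j s ^ 2 ≤ ∑ s, y j s ^ 2 :=
      Finset.single_le_sum (f := fun s => y j s ^ 2) (fun _ _ => sq_nonneg _) (Finset.mem_univ s)
    have h2 : ∑ s, y j s ^ 2 ≤ q y :=
      Finset.single_le_sum (f := fun j => ∑ s, y j s ^ 2)
        (fun _ _ => Finset.sum_nonneg fun _ _ => sq_nonneg _) (Finset.mem_univ j)
    rw [Real.norm_eq_abs, ← sq_le_one_iff_abs_le_one]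
    linarith
  have hsupp (k : ℝ → ℝ) (hk : ∀ t, 1 ≤ t → k t = 0) : HasCompactSupport (k ∘ q) := by
    refine HasCompactSupport.intro (isCompact_closedBall (0 : Mn n m) 1) fun y hy => ?_
    refine hk _ (not_lt.1 fun h => hy ?_)
    simpa using hqn y h
  refine ⟨g ∘ q, G ∘ q, hgs.comp hqs, hGs.comp hqs, hsupp g hg0, hsupp G hG0, ?_, ?_, ?_⟩
  · intro y hy
    exact hqn y (not_le.1 fun h => hy (hg0 _ h))
  · refine (hgs.comp hqs).continuous.integral_pos_of_hasCompactSupport_nonneg_nonzero (x := 0)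
      (hsupp g hg0) (fun y => Real.smoothTransition.nonneg _) ?_
    simp [hg, hq]
  · intro y j s
    have hqd : HasFDerivAt q (∑ j, ∑ s, (2 * y j s) •
        ((ContinuousLinearMap.proj (R := ℝ) (φ := fun _ : Fin (m + 1) => ℝ) s).comp
          (ContinuousLinearMap.proj j) :
          Mn n m →L[ℝ] ℝ)) y := by
      refine HasFDerivAt.fun_sum fun j _ => HasFDerivAt.fun_sum fun s _ => ?_
      have h : HasFDerivAt (fun y : Mn n m => y j s)
          ((ContinuousLinearMap.proj (R := ℝ) (φ := fun _ : Fin (m + 1) => ℝ) s).comp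
          (ContinuousLinearMap.proj j) : Mn n m →L[ℝ] ℝ) y :=
        ((ContinuousLinearMap.proj (R := ℝ) (φ := fun _ : Fin (m + 1) => ℝ) s).comp
          (ContinuousLinearMap.proj j) :
          Mn n m →L[ℝ] ℝ).hasFDerivAt
      simpa using h.pow 2
    rw [((hGd (q y)).comp_hasFDerivAt y hqd).fderiv]
    simp [Pi.single_apply, apply_ite]
    ring

/-- If the operators `A s t` satisfy the Clifford relations, contracting them with a symmetric
array yields its trace. -/
theorem sum_clifford_apply_of_symm {ι V : Type*} [Fintype ι] [DecidableEq ι] [AddCommGroup V]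
    [Module ℝ V] (A : ι → ι → V → V)
    (hA : ∀ s t a, A s t a + A t s a = if s = t then (2 : ℝ) • a else 0)
    (P : ι → ι → V) (hP : ∀ s t, P s t = P t s) :
    ∑ s, ∑ t, A s t (P s t) = ∑ s, P s s := by
  have h : (2 : ℝ) • ∑ s, ∑ t, A s t (P s t) = (2 : ℝ) • ∑ s, P s s := by
    calc (2 : ℝ) • ∑ s, ∑ t, A s t (P s t)
        = ∑ s, ∑ t, A s t (P s t) + ∑ s, ∑ t, A t s (P t s) := by
          rw [two_smul]; congr 1; exact Finset.sum_comm
      _ = ∑ s, ∑ t, (A s t (P s t) + A t s (P s t)) := by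
          simp only [← Finset.sum_add_distrib]
          refine Finset.sum_congr rfl fun s _ => Finset.sum_congr rfl fun t _ => ?_
          rw [hP t s]
      _ = (2 : ℝ) • ∑ s, P s s := by
          simp [hA, Finset.smul_sum]
  exact smul_right_injective V (two_ne_zero' ℝ) h

open scoped ContDiff in
/-- Mean value property with a radial weight, for compactly supported `C¹` functions satisfying
a first-order Clifford-type system on a ball. -/
theorem integral_smul_eq_of_clifford_system [CompleteSpace 𝔸]
    (A : Fin (m + 1) → Fin (m + 1) → 𝔸 →L[ℝ] 𝔸)
    (hA : ∀ s t a, A s t a + A t s a = if s = t then (2 : ℝ) • a else 0)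
    {φ Φ : Mn n m → ℝ} (hφ : ContDiff ℝ ∞ φ) (hΦ : ContDiff ℝ ∞ Φ)
    (hφc : HasCompactSupport φ) (hΦc : HasCompactSupport Φ)
    (hφ1 : ∀ y, φ y ≠ 0 → ‖y‖ ≤ 1)
    (hφΦ : ∀ y j s, fderiv ℝ Φ y (Pi.single j (Pi.single s 1)) = φ y * y j s)
    {f : Mn n m → 𝔸} (hf : ContDiff ℝ 1 f) (hfc : HasCompactSupport f)
    {x : Mn n m} {R : ℝ} (hR : 0 ≤ R)
    (hsys : ∀ z, ‖x - z‖ ≤ R → ∀ j s, ∑ t, A s t (pd f j t z) = 0) :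
    ∫ y, φ y • f (x - R • y) = (∫ y, φ y) • f x := by
  have hf' : Continuous (fderiv ℝ f) := hf.continuous_fderiv (by simp)
  have hderiv (r : ℝ) : HasDerivAt (fun r : ℝ => ∫ y, φ y • f (x - r • y))
      (∫ y, φ y • fderiv ℝ f (x - r • y) (-y)) r := by
    obtain ⟨C, hC⟩ := hf'.bounded_above_of_compact_support (hfc.fderiv ℝ)
    have hbound : Continuous (fun y : Mn n m => ‖φ y‖ * (C * ‖y‖)) := by
      have := hφ.continuous
      fun_prop
    refine (hasDerivAt_integral_of_dominated_loc_of_deriv_le (s := Set.univ)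
      (F := fun (r : ℝ) y => φ y • f (x - r • y))
      (F' := fun (r : ℝ) y => φ y • fderiv ℝ f (x - r • y) (-y))
      (bound := fun y => ‖φ y‖ * (C * ‖y‖)) Filter.univ_mem ?_ ?_ ?_ ?_ ?_ ?_).2
    · refine Filter.Eventually.of_forall fun r => Continuous.aestronglyMeasurable ?_
      exact hφ.continuous.smul (hf.continuous.comp (by fun_prop))
    · exact (hφ.continuous.smul (hf.continuous.comp (by fun_prop)))
        |>.integrable_of_hasCompactSupport hφc.smul_right
    · exact (hφ.continuous.smul ((hf'.comp (by fun_prop)).clm_apply continuous_neg))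
        |>.aestronglyMeasurable
    · refine Filter.Eventually.of_forall fun y r _ => ?_
      rw [norm_smul]
      gcongr
      refine (ContinuousLinearMap.le_opNorm _ _).trans ?_
      rw [norm_neg]
      gcongr
      exact hC _
    · exact hbound.integrable_of_hasCompactSupport hφc.norm.mul_right
    · refine Filter.Eventually.of_forall fun y r _ => ?_
      have h1 : HasDerivAt (fun r : ℝ => x - r • y) (-y) r := by
        simpa using ((hasDerivAt_id r).smul_const y).const_sub x
      have h2 := (hf.differentiable (by simp) (x - r • y)).hasFDerivAt
      exact (h2.comp_hasDerivAt r h1).const_smul (φ y)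
  have hzero (r : ℝ) (hr0 : 0 ≤ r) (hrR : r ≤ R) :
      ∫ y, φ y • fderiv ℝ f (x - r • y) (-y) = 0 := by
    set P : Fin n → Fin (m + 1) → Fin (m + 1) → 𝔸 := fun j s t =>
      ∫ y, pd Φ j s y • pd f j t (x - r • y) with hP
    have hint (j : Fin n) (s t : Fin (m + 1)) :
        Integrable (fun y => pd Φ j s y • pd f j t (x - r • y)) := by
      have h1 : Continuous (pd Φ j s) :=
        (hΦ.continuous_fderiv (by simp)).clm_apply continuous_const
      have h2 : Continuous (pd f j t) := hf'.clm_apply continuous_const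
      exact (h1.smul (h2.comp (by fun_prop))).integrable_of_hasCompactSupport
        (hΦc.fderiv_apply ℝ _).smul_right
    have hPsymm (j : Fin n) (s t : Fin (m + 1)) : P j s t = P j t s :=
      integral_fderiv_smul_fderiv_comm volume hΦ hΦc hf x r _ _
    have hsum (j : Fin n) : ∑ s, P j s s = 0 := by
      rw [← sum_clifford_apply_of_symm (fun s t => A s t) hA (P j) (hPsymm j)]
      refine Finset.sum_eq_zero fun s _ => ?_
      have : ∀ t, A s t (P j s t) = ∫ y, pd Φ j s y • A s t (pd f j t (x - r • y)) := fun t => by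
        rw [hP, ← ContinuousLinearMap.integral_comp_comm _ (hint j s t)]
        simp
      simp only [this]
      rw [← integral_finsetSum]
      · refine integral_eq_zero_of_ae (Filter.Eventually.of_forall fun y => ?_)
        simp only [← Finset.smul_sum, Pi.zero_apply]
        by_cases hy : φ y = 0
        · simp [pd, hφΦ, hy]
        · rw [hsys _ _ j s, smul_zero]
          rw [sub_sub_cancel, norm_smul, Real.norm_of_nonneg hr0]
          calc r * ‖y‖ ≤ r * 1 := by gcongr; exact hφ1 y hy
            _ ≤ R := by simpa using hrR
      · intro t _
        simpa using (A s t).integrable_comp (hint j s t)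
    have hpt (y : Mn n m) : φ y • fderiv ℝ f (x - r • y) (-y)
        = -∑ j, ∑ s, pd Φ j s y • pd f j s (x - r • y) := by
      have : fderiv ℝ f (x - r • y) y = ∑ j, ∑ s, y j s • pd f j s (x - r • y) := by
        have h := congrArg (fderiv ℝ f (x - r • y)) (sum_coord_smul_single y)
        simp only [map_sum, map_smul] at h
        exact h.symm
      rw [map_neg, smul_neg, this]
      simp only [Finset.smul_sum, smul_smul, pd, hφΦ]
    simp only [hpt, integral_neg]
    rw [integral_finsetSum _ fun j _ => integrable_finsetSum _ fun s _ => hint j s s,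
      neg_eq_zero]
    refine Finset.sum_eq_zero fun j _ => ?_
    rw [integral_finsetSum _ fun s _ => hint j s s]
    exact hsum j
  have hconst := constant_of_has_deriv_right_zero (a := 0) (b := R)
    (f := fun r : ℝ => ∫ y, φ y • f (x - r • y))
    (fun r _ => (hderiv r).continuousAt.continuousWithinAt)
    (fun r hr => by
      have := hderiv r
      rw [hzero r hr.1 hr.2.le] at this
      exact this.hasDerivWithinAt) R ⟨hR, le_rfl⟩
  simpa [integral_smul_const] using hconst

open scoped ContDiff in
/-- A `C¹` solution of a first-order Clifford-type system on an open set is smooth there. -/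
theorem contDiffAt_of_clifford_system [CompleteSpace 𝔸]
    (A : Fin (m + 1) → Fin (m + 1) → 𝔸 →L[ℝ] 𝔸)
    (hA : ∀ s t a, A s t a + A t s a = if s = t then (2 : ℝ) • a else 0)
    {Ω : Set (Mn n m)} (hΩ : IsOpen Ω) {f : Mn n m → 𝔸} (hf : ContDiffOn ℝ 1 f Ω)
    (hsys : ∀ z ∈ Ω, ∀ j s, ∑ t, A s t (pd f j t z) = 0) {x₀ : Mn n m} (hx₀ : x₀ ∈ Ω) :
    ContDiffAt ℝ ∞ f x₀ := by
  obtain ⟨ε, hε, hεΩ⟩ := Metric.nhds_basis_closedBall.mem_iff.1 (hΩ.mem_nhds hx₀)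
  let χ : ContDiffBump x₀ := ⟨ε / 2, ε, by positivity, by linarith⟩
  set F : Mn n m → 𝔸 := fun x => χ x • f x with hF
  have hFc : HasCompactSupport F := χ.hasCompactSupport.smul_right
  have hFs : ContDiff ℝ 1 F := by
    rw [contDiff_iff_contDiffAt]
    intro x
    by_cases hx : x ∈ Ω
    · exact χ.contDiffAt.smul (hf.contDiffAt (hΩ.mem_nhds hx))
    · have hx' : x ∉ tsupport χ := fun h => hx (hεΩ (by simpa [χ.tsupport_eq] using h))
      refine contDiffAt_const (c := (0 : 𝔸)) |>.congr_of_eventuallyEq ?_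
      filter_upwards [notMem_tsupport_iff_eventuallyEq.1 hx'] with y hy
      simp [hF, hy]
  have hFf (x : Mn n m) (hx : x ∈ Metric.ball x₀ (ε / 2)) : F =ᶠ[nhds x] f := by
    filter_upwards [χ.eventuallyEq_one_of_mem_ball hx] with y hy
    simp [hF, hy]
  obtain ⟨φ, Φ, hφ, hΦ, hφc, hΦc, hφ1, hpos, hφΦ⟩ := exists_radial_bump_potential n m
  set R : ℝ := ε / 4 with hRdef
  have hR : 0 < R := by positivity
  have hmean (x : Mn n m) (hx : x ∈ Metric.ball x₀ R) :
      ∫ y, φ y • F (x - R • y) = (∫ y, φ y) • F x := by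
    refine integral_smul_eq_of_clifford_system A hA hφ hΦ hφc hΦc hφ1 hφΦ hFs hFc hR.le ?_
    intro z hz j s
    have hz' : z ∈ Metric.ball x₀ (ε / 2) := by
      rw [Metric.mem_ball] at hx ⊢
      rw [← dist_eq_norm, dist_comm] at hz
      linarith [dist_triangle z x x₀]
    have hzΩ : z ∈ Ω := hεΩ (Metric.ball_subset_closedBall.trans
      (Metric.closedBall_subset_closedBall (by linarith)) hz')
    simpa only [pd, (hFf z hz').fderiv_eq] using hsys z hzΩ j s
  set ψ : Mn n m → ℝ := fun y => φ (R⁻¹ • y) with hψ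
  have hψs : ContDiff ℝ ∞ ψ := hφ.comp (by fun_prop)
  have hψc : HasCompactSupport ψ :=
    hφc.comp_homeomorph (Homeomorph.smulOfNeZero R⁻¹ (inv_ne_zero hR.ne'))
  set c : ℝ := |R ^ Module.finrank ℝ (Mn n m)| * ∫ y, φ y with hc
  have hcpos : 0 < c := by positivity
  have hconv : ContDiff ℝ ∞ (fun x => ∫ y, ψ y • F (x - y)) :=
    hψc.contDiff_convolution_left (ContinuousLinearMap.lsmul ℝ ℝ) hψs
      (hFs.continuous.locallyIntegrable (μ := volume))
  have hloc : F =ᶠ[nhds x₀] fun x => c⁻¹ • ∫ y, ψ y • F (x - y) := by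
    filter_upwards [Metric.ball_mem_nhds x₀ hR] with x hx
    have h := Measure.integral_comp_inv_smul volume (fun y => φ y • F (x - R • y)) R
    simp only [smul_inv_smul₀ hR.ne'] at h
    rw [hmean x hx, smul_smul, ← hc] at h
    rw [h, smul_smul, inv_mul_cancel₀ hcpos.ne', one_smul]
  exact ((hconv.const_smul c⁻¹).contDiffAt.congr_of_eventuallyEq hloc).congr_of_eventuallyEq
    (hFf x₀ (Metric.mem_ball_self (by positivity))).symm

/-- Conjugation negates the imaginary units of a hypercomplex basis. -/
theorem HCAlg.conj_v (H : HCAlg 𝔸 m) {s : Fin (m + 1)} (hs : s ≠ 0) :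
    H.conj (H.v s) = -H.v s :=
  eq_neg_of_add_eq_zero_right (H.v_trace s hs)

/-- The linearized left alternative law. -/
theorem HCAlg.mul_mul_add_mul_mul_s8 (H : HCAlg 𝔸 m) (a b c : 𝔸) :
    H.mul a (H.mul b c) + H.mul b (H.mul a c) = H.mul (H.mul a b + H.mul b a) c := by
  have h := H.alt_left (a + b) c
  simp only [map_add, LinearMap.add_apply, H.alt_left a c, H.alt_left b c] at h ⊢
  rw [← sub_eq_zero] at h ⊢
  rw [← h]
  abel

/-- The Clifford relations for left multiplications by a hypercomplex basis. -/
theorem HCAlg.conj_mul_mul_add (H : HCAlg 𝔸 m) (s t : Fin (m + 1)) (a : 𝔸) :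
    H.mul (H.conj (H.v s)) (H.mul (H.v t) a) + H.mul (H.conj (H.v t)) (H.mul (H.v s) a)
      = if s = t then (2 : ℝ) • a else 0 := by
  split_ifs with hst
  · subst hst
    rw [two_smul]
    by_cases hs : s = 0
    · simp [hs, H.v_zero, H.conj_one, H.one_mul']
    · have h := H.v_norm s hs
      rw [H.conj_v hs, map_neg] at h
      have h1 : H.mul (-H.v s) (H.mul (H.v s) a) = a := by
        rw [map_neg, LinearMap.neg_apply, H.alt_left, ← LinearMap.neg_apply, ← map_neg, h,
          H.one_mul']
      rw [H.conj_v hs, h1]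
  · by_cases hs : s = 0
    · subst hs
      simp [H.v_zero, H.conj_one, H.one_mul', H.conj_v (Ne.symm hst)]
    · by_cases ht : t = 0
      · subst ht
        simp [H.v_zero, H.conj_one, H.one_mul', H.conj_v hst]
      · rw [H.conj_v hs, H.conj_v ht, map_neg, map_neg, LinearMap.neg_apply, LinearMap.neg_apply,
          ← neg_add, H.mul_mul_add_mul_mul_s8, H.v_anticomm s t hs ht hst]
        simp

/-- **Regularity of monogenic functions** (Remark 2.9): a left monogenic function on a
domain `Ω ⊆ M^n` is harmonic on `Ω` (its `𝔸`-valued Laplacian vanishes, equivalently every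
real component satisfies Laplace's equation `∑_{j,s} ∂²u/∂x_{j,s}² = 0`) and, in
particular, of class `C^∞` on `Ω`. -/
theorem monogenic_regularity (H : HCAlg 𝔸 m) (hn : 0 < n)
    (Ω : Set (Mn n m)) (hΩo : IsOpen Ω) (hΩc : IsConnected Ω)
    (f : Mn n m → 𝔸) (hf : ContDiffOn ℝ 1 f Ω)
    (hmono : ∀ x ∈ Ω, ∀ j : Fin n, dbar H f j x = 0) :
    ContDiffOn ℝ (⊤ : ℕ∞) f Ω ∧ ∀ x ∈ Ω, ∑ j, lap f j x = 0 := by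
  have := H.findim
  have : CompleteSpace 𝔸 := FiniteDimensional.complete ℝ 𝔸
  let A : Fin (m + 1) → Fin (m + 1) → 𝔸 →L[ℝ] 𝔸 := fun s t =>
    LinearMap.toContinuousLinearMap ((H.mul (H.conj (H.v s))).comp (H.mul (H.v t)))
  have hA : ∀ s t a, A s t a + A t s a = if s = t then (2 : ℝ) • a else 0 :=
    H.conj_mul_mul_add
  have hsys : ∀ z ∈ Ω, ∀ j s, ∑ t, A s t (pd f j t z) = 0 := fun z hz j s => by
    have h := congrArg (H.mul (H.conj (H.v s))) (hmono z hz j)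
    simp only [dbar, map_sum, map_zero] at h
    exact h
  have hsmooth (x : Mn n m) (hx : x ∈ Ω) : ContDiffAt ℝ (⊤ : ℕ∞) f x :=
    contDiffAt_of_clifford_system A hA hΩo hf hsys hx
  refine ⟨fun x hx => (hsmooth x hx).contDiffWithinAt, fun x hx => ?_⟩
  refine Finset.sum_eq_zero fun j _ => ?_
  have hd : DifferentiableAt ℝ (fderiv ℝ f) x :=
    ((hsmooth x hx).fderiv_right (m := 1) (by norm_cast)).differentiableAt (by simp)
  have hpd (t : Fin (m + 1)) : DifferentiableAt ℝ (pd f j t) x :=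
    hd.clm_apply (differentiableAt_const _)
  have hsymm (s t : Fin (m + 1)) : pd (pd f j t) j s x = pd (pd f j s) j t x := by
    have h := (hsmooth x hx).isSymmSndFDerivAt
      (by simpa using WithTop.coe_le_coe.2 (le_top (a := (2 : ℕ∞))))
      (Pi.single j (Pi.single s 1)) (Pi.single j (Pi.single t 1))
    have h2 (s t : Fin (m + 1)) : pd (pd f j t) j s x = fderiv ℝ (fderiv ℝ f) x
        (Pi.single j (Pi.single s 1)) (Pi.single j (Pi.single t 1)) := by
      unfold pd
      rw [fderiv_clm_apply hd (by fun_prop)]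
      simp
    rw [h2, h2, h]
  rw [lap, ← sum_clifford_apply_of_symm (fun s t => A s t) hA
    (fun s t => pd (pd f j t) j s x) hsymm]
  refine Finset.sum_eq_zero fun s _ => ?_
  have h0 : (fun z => ∑ t, A s t (pd f j t z)) =ᶠ[nhds x] fun _ => 0 := by
    filter_upwards [hΩo.mem_nhds hx] with z hz using hsys z hz j s
  have h1 : HasFDerivAt (fun z => ∑ t, A s t (pd f j t z))
      (∑ t, (A s t).comp (fderiv ℝ (pd f j t) x)) x :=
    HasFDerivAt.fun_sum fun t _ => (A s t).hasFDerivAt.comp x (hpd t).hasFDerivAt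
  have h2 := h1.fderiv.symm.trans (h0.fderiv_eq.trans (fderiv_const_apply _))
  simpa [pd] using congrArg (fun L => L (Pi.single j (Pi.single s 1))) h2

end
end
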